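/- arXiv:1308.0621 — 2 statements merged into one kernel-verified Lean document; each statement's English description precedes it below -/
import Mathlib

section
/- Let G be a subgroup of Sym(12) (permutations of a 12-element set) whose natural action is sharply 5-transitive, i.e., for any two 5-tuples of pairwise distinct points there is exactly one g ∈ G mapping the first tuple to the second (equivalently, G is 5-transitive and |G| = 12·11·10·9·8 = 95040; such a G is the Mathieu group M_{12}). Then G has the strict EKR property: every intersecting subset S ⊆ G satisfies |S| ≤ 7920, and every intersecting subset of size 7920 equals S_{i,j} = {π ∈ G : π(i) = j} for some points i,j. -/
open Finset in
/-- The number of points on which two permutations agree. -/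
def agreement (π σ : Equiv.Perm (Fin 12)) : ℕ := #{i | π i = σ i}

open Finset in
/-- The product over `A` of the entries `12 [π i = σ i] - 1` is a positive semidefinite kernel. -/
theorem sum_mul_prod_agreement_nonneg {Γ : Type*} [Fintype Γ] (r : Γ → Equiv.Perm (Fin 12))
    (A : Finset (Fin 12)) (f : Γ → ℝ) :
    0 ≤ ∑ π, ∑ σ, f π * f σ * ∏ i ∈ A, (if r π i = r σ i then (11 : ℝ) else -1) := by
  induction A using Finset.induction_on generalizing f with
  | empty =>
    simp only [prod_empty, mul_one, ← mul_sum, ← sum_mul]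
    exact mul_self_nonneg _
  | insert i A hi ih =>
    have entry (x y : Fin 12) : (if x = y then (11 : ℝ) else -1) =
        12⁻¹ * ∑ b, (if x = b then (11 : ℝ) else -1) * (if y = b then (11 : ℝ) else -1) := by
      revert x y
      have h : ∀ x y : Fin 12, (if x = y then (132 : ℤ) else -12) =
        ∑ b, (if x = b then (11 : ℤ) else -1) * (if y = b then (11 : ℤ) else -1) := by decide
      intro x y
      have := congrArg (fun z : ℤ => (z : ℝ)) (h x y)
      push_cast at this
      rw [← this]
      split_ifs <;> norm_num
    have expand : ∑ π, ∑ σ, f π * f σ *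
          ∏ i ∈ insert i A, (if r π i = r σ i then (11 : ℝ) else -1) =
        12⁻¹ * ∑ b, ∑ π, ∑ σ, (f π * if r π i = b then 11 else -1) *
          (f σ * if r σ i = b then 11 else -1) *
          ∏ i ∈ A, (if r π i = r σ i then (11 : ℝ) else -1) := by
      symm
      rw [sum_comm, mul_sum]
      refine sum_congr rfl fun π _ => ?_
      rw [sum_comm, mul_sum]
      refine sum_congr rfl fun σ _ => ?_
      rw [prod_insert hi, entry]
      simp only [mul_sum, sum_mul]
      exact sum_congr rfl fun b _ => by ring
    rw [expand]
    exact mul_nonneg (by norm_num) (sum_nonneg fun b _ => ih _)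

open Finset in
theorem sum_prod_agreement_eq_esymm (π σ : Equiv.Perm (Fin 12)) (k : ℕ) :
    ∑ A ∈ powersetCard k univ, ∏ i ∈ A, (if π i = σ i then (11 : ℤ) else -1) =
      (Multiset.replicate (agreement π σ) 11 +
        Multiset.replicate (12 - agreement π σ) (-1 : ℤ)).esymm k := by
  rw [← Finset.esymm_map_val]
  congr 1
  have hc : 12 - agreement π σ = #{i | ¬ π i = σ i} := by
    have := card_filter_add_card_filter_not (s := (univ : Finset (Fin 12))) (fun i => π i = σ i)
    rw [agreement]
    simp only [card_univ, Fintype.card_fin] at this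
    omega
  rw [hc, agreement, ← Multiset.filter_add_not (fun i => π i = σ i) (univ : Finset (Fin 12)).val,
    Multiset.map_add]
  congr 1 <;> refine Multiset.eq_replicate.2 ⟨by simp [Finset.card_def], ?_⟩ <;>
    simp +contextual

theorem derangement_kernel_decomposition (x : ℕ) (hx : x ≤ 4 ∨ x = 12) :
    ((Multiset.replicate x 11 + Multiset.replicate (12 - x) (-1 : ℤ)).esymm 5 : ℤ) +
      20 * (Multiset.replicate x 11 + Multiset.replicate (12 - x) (-1 : ℤ)).esymm 4 +
      948 * (Multiset.replicate x 11 + Multiset.replicate (12 - x) (-1 : ℤ)).esymm 2 -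
      88056 * (x : ℤ) + 177156 =
    248832 * ((if x = 0 then 1 else 0) + if x = 12 then 1122 else 0) := by
  have : x ∈ ({0, 1, 2, 3, 4, 12} : Finset ℕ) := by
    simp only [Finset.mem_insert, Finset.mem_singleton]; omega
  clear hx
  revert x
  decide +kernel

theorem agreement_self (π : Equiv.Perm (Fin 12)) : agreement π π = 12 := by
  simp [agreement]

open Finset in
theorem agreement_mul_mul (τ π σ ρ : Equiv.Perm (Fin 12)) :
    agreement (τ * π * ρ) (τ * σ * ρ) = agreement π σ := by
  refine card_bij (fun i _ => ρ i) ?_ (fun _ _ _ _ h => ρ.injective h)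
    fun i hi => ⟨ρ⁻¹ i, ?_, by simp⟩
  · simp
  · simpa using hi

open Finset in
/-- The derangement form of a family in which distinct permutations agree on at most four points
is bounded below on functions all of whose one-point marginals vanish. -/
theorem derangement_form_lower_bound {Γ : Type*} [Fintype Γ] [DecidableEq Γ]
    (r : Γ → Equiv.Perm (Fin 12)) (hr : ∀ π σ, agreement (r π) (r σ) ≤ 4 ∨ π = σ) (f : Γ → ℝ)
    (hf : ∀ i j, ∑ π, (if r π i = j then f π else 0) = 0) :
    -1122 * ∑ π, f π ^ 2 ≤
      ∑ π, ∑ σ, f π * f σ * if agreement (r π) (r σ) = 0 then 1 else 0 := by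
  have esymm_nonneg (k : ℕ) : 0 ≤ ∑ π, ∑ σ, f π * f σ *
      (((Multiset.replicate (agreement (r π) (r σ)) 11 +
        Multiset.replicate (12 - agreement (r π) (r σ)) (-1 : ℤ)).esymm k : ℤ) : ℝ) := by
    have := sum_nonneg fun A (_ : A ∈ powersetCard k (univ : Finset (Fin 12))) =>
      sum_mul_prod_agreement_nonneg r A f
    rw [sum_comm] at this
    refine this.trans_eq (sum_congr rfl fun π _ => ?_)
    rw [sum_comm]
    refine sum_congr rfl fun σ _ => ?_
    rw [← sum_prod_agreement_eq_esymm, ← mul_sum]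
    push_cast
    rfl
  have sum_zero : ∑ π, f π = 0 := by
    have : ∑ j, ∑ π, (if r π 0 = j then f π else 0) = 0 := by simp [hf]
    rw [sum_comm] at this
    simpa using this
  have agreement_zero : ∑ π, ∑ σ, f π * f σ * (agreement (r π) (r σ) : ℝ) = 0 := by
    have h (π) : ∑ σ, f π * f σ * (agreement (r π) (r σ) : ℝ) = 0 := by
      have : ∑ i, ∑ σ, (if r σ i = r π i then f σ else 0) = 0 := by simp [hf]
      rw [sum_comm] at this
      calc _ = f π * ∑ σ, ∑ i, (if r σ i = r π i then f σ else 0) := by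
            rw [mul_sum]
            refine sum_congr rfl fun σ _ => ?_
            rw [← sum_filter, sum_const, agreement, nsmul_eq_mul]
            simp only [eq_comm]
            ring
        _ = 0 := by rw [this, mul_zero]
    simp [h]
  have diag : ∑ π, ∑ σ, f π * f σ * (if agreement (r π) (r σ) = 12 then 1122 else 0) =
      1122 * ∑ π, f π ^ 2 := by
    rw [mul_sum]
    refine sum_congr rfl fun π _ => ?_
    rw [sum_eq_single π]
    · simp only [agreement_self, if_true]; ring
    · intro σ _ hσ
      have := (hr π σ).resolve_right (Ne.symm hσ)
      rw [if_neg (by omega), mul_zero]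
    · simp
  have key : ∀ π σ, f π * f σ * (if agreement (r π) (r σ) = 0 then (1 : ℝ) else 0) =
      248832⁻¹ * (f π * f σ * (((Multiset.replicate (agreement (r π) (r σ)) 11 +
        Multiset.replicate (12 - agreement (r π) (r σ)) (-1 : ℤ)).esymm 5 : ℤ) : ℝ)) +
      248832⁻¹ * 20 * (f π * f σ * (((Multiset.replicate (agreement (r π) (r σ)) 11 +
        Multiset.replicate (12 - agreement (r π) (r σ)) (-1 : ℤ)).esymm 4 : ℤ) : ℝ)) +
      248832⁻¹ * 948 * (f π * f σ * (((Multiset.replicate (agreement (r π) (r σ)) 11 +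
        Multiset.replicate (12 - agreement (r π) (r σ)) (-1 : ℤ)).esymm 2 : ℤ) : ℝ)) -
      248832⁻¹ * 88056 * (f π * f σ * (agreement (r π) (r σ) : ℝ)) +
      248832⁻¹ * 177156 * (f π * f σ) -
      f π * f σ * (if agreement (r π) (r σ) = 12 then 1122 else 0) := by
    intro π σ
    have h := derangement_kernel_decomposition (agreement (r π) (r σ))
      ((hr π σ).imp id fun h => by rw [h, agreement_self])
    have h' := congrArg (fun z : ℤ => (z : ℝ)) h
    push_cast at h'
    linear_combination (-(248832⁻¹ : ℝ) * f π * f σ) * h'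
  simp only [key, sum_sub_distrib, sum_add_distrib, ← mul_sum, sum_zero, mul_zero, sum_const_zero,
    agreement_zero, diag]
  linarith [esymm_nonneg 5, esymm_nonneg 4, esymm_nonneg 2]

open Finset in
theorem card_mul_card_smul_eq {Γ X : Type*} [Group Γ] [Fintype Γ] [Fintype X] [DecidableEq X]
    [act : MulAction Γ X] [MulAction.IsPretransitive Γ X] (x y : X) :
    Fintype.card X * #{g : Γ | g • x = y} = Fintype.card Γ := by
  have h (z : X) : #{g : Γ | g • x = z} = #{g : Γ | g • x = y} := by
    obtain ⟨k, rfl⟩ := MulAction.exists_smul_eq Γ z y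
    refine card_bij (fun g _ => k * g) ?_ (fun _ _ _ _ h => mul_left_cancel h)
      fun g hg => ⟨k⁻¹ * g, ?_, by simp⟩
    · simp +contextual [mul_smul]
    · simp only [mem_filter, mem_univ, true_and] at hg ⊢
      rw [mul_smul, hg, inv_smul_smul]
  have hsum : Fintype.card Γ = ∑ z : X, #{g : Γ | g • x = z} :=
    card_eq_sum_card_fiberwise (f := fun g : Γ => g • x) (t := univ) (by simp)
  simp only [hsum, h, sum_const, card_univ, smul_eq_mul]

open Finset in
/-- A nonnegative matrix with all line sums `7920` whose permutation sums take only the values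
`7200` and `15840` has an entry equal to `7920`. -/
theorem exists_eq_of_permutation_sums (N : Fin 12 → Fin 12 → ℤ) (hN : ∀ i j, 0 ≤ N i j)
    (row : ∀ i, ∑ j, N i j = 7920) (col : ∀ j, ∑ i, N i j = 7920)
    (hperm : ∀ σ : Equiv.Perm (Fin 12), ∑ i, N i (σ i) = 7200 ∨ ∑ i, N i (σ i) = 15840) :
    ∃ i j, N i j = 7920 := by
  obtain ⟨⟨i, j⟩, -, hmax⟩ := exists_max_image (univ : Finset (Fin 12 × Fin 12))
    (fun c => N c.1 c.2) univ_nonempty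
  replace hmax : ∀ m q, N m q ≤ N i j := fun m q => hmax (m, q) (mem_univ _)
  have le (m q) : N m q ≤ 7920 :=
    (single_le_sum (fun q _ => hN m q) (mem_univ q)).trans_eq (row m)
  have alternant (m q) : N i j + N m q - N i q - N m j = 0 ∨
      (N i j + N m q - N i q - N m j = 8640 ∧ m ≠ i ∧ q ≠ j) := by
    by_cases hm : m = i
    · left; subst hm; ring
    by_cases hq : q = j
    · left; subst hq; ring
    obtain ⟨σ, hσi, hσm⟩ : ∃ σ : Equiv.Perm (Fin 12), σ i = j ∧ σ m = q := by
      let τ := Equiv.swap i j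
      refine ⟨Equiv.swap (τ m) q * τ, ?_, by simp⟩
      have h1 : τ i = j := Equiv.swap_apply_left i j
      rw [Equiv.Perm.mul_apply, h1, Equiv.swap_apply_of_ne_of_ne _ (Ne.symm hq)]
      rw [← h1]
      exact fun h => hm (τ.injective h).symm
    have diff : ∑ a, N a (σ a) - ∑ a, N a ((σ * Equiv.swap i m) a) =
        N i j + N m q - N i q - N m j := by
      rw [← sum_sub_distrib, ← sum_subset (subset_univ {i, m}), sum_pair (Ne.symm hm)]
      · simp only [Equiv.Perm.mul_apply, Equiv.swap_apply_left, Equiv.swap_apply_right, hσi, hσm]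
        ring
      · intro a _ ha
        simp only [mem_insert, mem_singleton, not_or] at ha
        simp [Equiv.swap_apply_of_ne_of_ne ha.1 ha.2]
    have h1 := hmax i q
    have h2 := le m j
    have h3 := hN m q
    rcases hperm σ with h | h <;> rcases hperm (σ * Equiv.swap i m) with h' | h' <;>
      rw [h, h'] at diff
    · left; omega
    · omega
    · right; exact ⟨by omega, hm, hq⟩
    · left; omega
  have column_sum (q) : ∑ m, (N i j + N m q - N i q - N m j) = 12 * (N i j - N i q) := by
    simp only [sum_sub_distrib, sum_add_distrib, col, sum_const, card_univ, Fintype.card_fin]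
    ring
  have row_sum (m) : ∑ q, (N i j + N m q - N i q - N m j) = 12 * (N i j - N m j) := by
    simp only [sum_sub_distrib, sum_add_distrib, row, sum_const, card_univ, Fintype.card_fin]
    ring
  have half : 4320 ≤ N i j := by
    by_contra hlt
    have zero (m q) : N i j + N m q - N i q - N m j = 0 := by
      refine (alternant m q).resolve_right fun ⟨h, _⟩ => ?_
      have := hmax m q
      have := hN i q
      have := hN m j
      omega
    have const (m q) : N m q = N i j := by
      have h1 := column_sum q
      have h2 := row_sum m
      have h3 := zero m q
      simp only [zero, sum_const_zero] at h1 h2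
      omega
    have h1 := row i
    have h2 := hperm 1
    simp only [const, sum_const, card_univ, Fintype.card_fin] at h1 h2
    omega
  have exists_jump (q) (hq : q ≠ j) : ∃ m, N i j + N m q - N i q - N m j = 8640 := by
    by_contra! hne
    have h1 := column_sum q
    rw [sum_eq_zero fun m _ => (alternant m q).resolve_right fun h => hne m h.1] at h1
    have h2 := row i
    have h3 := sum_le_univ_sum_of_nonneg (s := {j, q}) (hN i)
    rw [sum_pair (Ne.symm hq)] at h3
    omega
  obtain ⟨m, -, hmin⟩ := exists_min_image (univ : Finset (Fin 12)) (fun m => N m j) univ_nonempty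
  have jump (q) (hq : q ≠ j) : N i j + N m q - N i q - N m j = 8640 := by
    obtain ⟨k, hk⟩ := exists_jump q hq
    refine ((alternant m q).resolve_left fun h => ?_).1
    have h1 := hmax k q
    have h2 := hmin k (mem_univ k)
    have h3 := hN m q
    have h4 := le i j
    omega
  have h1 := row_sum m
  rw [← add_sum_erase _ _ (mem_univ j), sum_congr rfl fun q hq => jump q (ne_of_mem_erase hq)] at h1
  simp only [sum_const, card_erase_of_mem (mem_univ j), card_univ, Fintype.card_fin] at h1
  refine ⟨i, j, ?_⟩
  have h2 := hN m j
  have h3 := le i j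
  norm_num at h1
  omega

open Finset in
theorem sum_mul_sum_apply {Γ : Type*} [Fintype Γ] (r : Γ → Equiv.Perm (Fin 12)) (w : Γ → ℝ)
    (N : Fin 12 → Fin 12 → ℝ) :
    ∑ g, w g * ∑ k, N k (r g k) = ∑ k, ∑ l, N k l * ∑ g, (if r g k = l then w g else 0) := by
  simp only [mul_sum]
  rw [sum_comm]
  refine sum_congr rfl fun k _ => ?_
  rw [sum_comm]
  refine sum_congr rfl fun g _ => ?_
  simp [mul_comm]

open Finset in
theorem card_apply_eq {G : Subgroup (Equiv.Perm (Fin 12))} [Fintype G]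
    [h5 : MulAction.IsMultiplyPretransitive G (Fin 12) 5] (hG : Fintype.card G = 95040)
    (i j : Fin 12) : #{g : G | (g : Equiv.Perm (Fin 12)) i = j} = 7920 := by
  have : MulAction.IsMultiplyPretransitive G (Fin 12) 1 :=
    MulAction.isMultiplyPretransitive_of_le (n := 5) (by norm_num) (by simp)
  have : MulAction.IsPretransitive G (Fin 12) := MulAction.is_one_pretransitive_iff.mp this
  have h := card_mul_card_smul_eq (Γ := G) i j
  simp only [Fintype.card_fin, hG] at h
  change 12 * #{g : G | (g : Equiv.Perm (Fin 12)) i = j} = 95040 at h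
  omega

open Finset in
theorem card_apply_eq_and_apply_eq {G : Subgroup (Equiv.Perm (Fin 12))} [Fintype G]
    [h5 : MulAction.IsMultiplyPretransitive G (Fin 12) 5] (hG : Fintype.card G = 95040)
    {i k j l : Fin 12} (hik : i ≠ k) (hjl : j ≠ l) :
    #{g : G | (g : Equiv.Perm (Fin 12)) i = j ∧ (g : Equiv.Perm (Fin 12)) k = l} = 720 := by
  have : MulAction.IsMultiplyPretransitive G (Fin 12) 2 :=
    MulAction.isMultiplyPretransitive_of_le (n := 5) (by norm_num) (by simp)
  have pair {a b : Fin 12} (hab : a ≠ b) : Function.Injective ![a, b] := by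
    intro x y; fin_cases x <;> fin_cases y <;> simp [hab, hab.symm]
  have h := card_mul_card_smul_eq (Γ := G) (act := Function.Embedding.instMulAction)
    (⟨_, pair hik⟩ : Fin 2 ↪ Fin 12) ⟨_, pair hjl⟩
  have hX : Fintype.card (Fin 2 ↪ Fin 12) = 132 := by
    simp [Fintype.card_embedding_eq, Nat.descFactorial]
  rw [hX, hG] at h
  have heq (g : G) : (g • (⟨_, pair hik⟩ : Fin 2 ↪ Fin 12) = ⟨_, pair hjl⟩) ↔
      (g : Equiv.Perm (Fin 12)) i = j ∧ (g : Equiv.Perm (Fin 12)) k = l := by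
    rw [DFunLike.ext_iff, Fin.forall_fin_two]
    rfl
  simp only [heq] at h
  omega

open Finset in
theorem agreement_one_left (σ : Equiv.Perm (Fin 12)) : agreement 1 σ = #{i | σ i = i} :=
  congrArg card (filter_congr fun _ _ => eq_comm)

open Finset in
/-- The number of derangements relative to `π` that map `i` to `j` does not depend on `π`, `i` and
`j` as long as `π i ≠ j`. -/
theorem exists_card_derangements_mapping {G : Subgroup (Equiv.Perm (Fin 12))} [Fintype G]
    [h5 : MulAction.IsMultiplyPretransitive G (Fin 12) 5] (hG : Fintype.card G = 95040)
    (h4 : ∀ π σ : G, agreement π σ ≤ 4 ∨ π = σ) :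
    ∃ d : ℕ, 1122 < d ∧ ∀ (π : G) (i j : Fin 12),
      #{σ : G | agreement π σ = 0 ∧ (σ : Equiv.Perm (Fin 12)) i = j} =
        if (π : Equiv.Perm (Fin 12)) i = j then 0 else d := by
  have : MulAction.IsMultiplyPretransitive G (Fin 12) 2 :=
    MulAction.isMultiplyPretransitive_of_le (n := 5) (by norm_num) (by simp)
  set d := #{σ : G | agreement 1 σ = 0 ∧ (σ : Equiv.Perm (Fin 12)) 0 = 1}
  have hW (π : G) (i j : Fin 12) :
      #{σ : G | agreement π σ = 0 ∧ (σ : Equiv.Perm (Fin 12)) i = j} =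
        if (π : Equiv.Perm (Fin 12)) i = j then 0 else d := by
    split_ifs with hij
    · rw [card_eq_zero, filter_eq_empty_iff]
      rintro σ - ⟨h, hσ⟩
      rw [agreement, card_eq_zero, filter_eq_empty_iff] at h
      exact h (mem_univ i) (hij.trans hσ.symm)
    · obtain ⟨τ, hτ⟩ := MulAction.is_two_pretransitive_iff.mp this hij
        (show (0 : Fin 12) ≠ 1 by decide)
      replace hτ : (τ : Equiv.Perm (Fin 12)) ((π : Equiv.Perm (Fin 12)) i) = 0 ∧
        (τ : Equiv.Perm (Fin 12)) j = 1 := hτ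
      have hρ : ((π⁻¹ * τ⁻¹ : G) : Equiv.Perm (Fin 12)) 0 = i := by
        simp [← hτ.1]
      have key (σ : G) : (agreement π σ = 0 ∧ (σ : Equiv.Perm (Fin 12)) i = j) ↔
          agreement 1 (τ * σ * (π⁻¹ * τ⁻¹) : G) = 0 ∧
            ((τ * σ * (π⁻¹ * τ⁻¹) : G) : Equiv.Perm (Fin 12)) 0 = 1 := by
        have h1 := agreement_mul_mul τ π σ (π⁻¹ * τ⁻¹ : G)
        have h2 : ((τ : Equiv.Perm (Fin 12)) * π * (π⁻¹ * τ⁻¹ : G)) = 1 := by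
          push_cast; group
        rw [h2] at h1
        rw [Subgroup.coe_mul, Subgroup.coe_mul, h1, Equiv.Perm.mul_apply, hρ,
          Equiv.Perm.mul_apply, ← hτ.2, EmbeddingLike.apply_eq_iff_eq]
      refine card_bij (fun σ _ => τ * σ * (π⁻¹ * τ⁻¹)) ?_ ?_ ?_
      · intro σ hσ
        simpa only [mem_filter, mem_univ, true_and] using (key σ).mp (by simpa using hσ)
      · intro _ _ _ _ h
        exact mul_left_cancel (mul_right_cancel h)
      · intro σ hσ
        refine ⟨τ⁻¹ * σ * (π⁻¹ * τ⁻¹)⁻¹, ?_, by group⟩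
        simp only [mem_filter, mem_univ, true_and] at hσ ⊢
        rw [key]
        have : τ * (τ⁻¹ * σ * (π⁻¹ * τ⁻¹)⁻¹) * (π⁻¹ * τ⁻¹) = σ := by group
        rwa [this]
  refine ⟨d, ?_, hW⟩
  have hD : #{σ : G | agreement 1 σ = 0} = 11 * d := by
    rw [card_eq_sum_card_fiberwise (f := fun g : G => (g : Equiv.Perm (Fin 12)) 0) (t := univ)
      (by simp)]
    simp only [filter_filter]
    have h := hW 1 0
    simp only [Subgroup.coe_one] at h
    simp only [h, Equiv.Perm.one_apply, Fin.sum_univ_succ]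
    simp [Fin.ext_iff]
    ring
  have card_eq (p : Equiv.Perm (Fin 12) → Prop) [DecidablePred p] :
      (#{g : G | p g} : ℤ) = ∑ g : G, if p g then 1 else 0 := by simp
  have sum1 : ∑ g : G, (agreement 1 g : ℤ) = 95040 := by
    simp only [agreement_one_left, card_filter, Nat.cast_sum, Nat.cast_ite, Nat.cast_one,
      Nat.cast_zero]
    rw [sum_comm]
    have h (i : Fin 12) : ∑ g : G, (if (g : Equiv.Perm (Fin 12)) i = i then (1 : ℤ) else 0) =
        7920 := by
      rw [← card_eq (fun g => g i = i)]
      rw [card_apply_eq hG]; rfl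
    simp [h]
  have sum2 : ∑ g : G, (agreement 1 g : ℤ) ^ 2 = 2 * 95040 := by
    simp only [agreement_one_left, card_filter, Nat.cast_sum, Nat.cast_ite, Nat.cast_one,
      Nat.cast_zero, sq, sum_mul_sum]
    rw [sum_comm]
    have h (i k : Fin 12) : ∑ g : G, ((if (g : Equiv.Perm (Fin 12)) i = i then (1 : ℤ) else 0) *
        if (g : Equiv.Perm (Fin 12)) k = k then (1 : ℤ) else 0) = if i = k then 7920 else 720 := by
      simp only [ite_zero_mul_ite_zero, mul_one]
      rw [← card_eq (fun g => g i = i ∧ g k = k)]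
      split_ifs with hik
      · subst hik
        simp only [and_self_iff]
        rw [card_apply_eq hG]; rfl
      · rw [card_apply_eq_and_apply_eq hG hik hik]; rfl
    have h' (i : Fin 12) : ∑ g : G, ∑ k, ((if (g : Equiv.Perm (Fin 12)) i = i then (1 : ℤ) else 0) *
        if (g : Equiv.Perm (Fin 12)) k = k then (1 : ℤ) else 0) = 15840 := by
      rw [sum_comm]
      simp only [h]
      revert i; decide
    simp only [h']
    rfl
  have pointwise (g : G) : (agreement 1 g : ℤ) ^ 2 - 5 * agreement 1 g + 4 ≤
      4 * (if agreement 1 g = 0 then 1 else 0) + 88 * (if (1 : G) = g then 1 else 0) := by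
    by_cases hg : (1 : G) = g
    · subst hg
      simp only [Subgroup.coe_one, agreement_self]
      norm_num
    · have := (h4 1 g).resolve_right hg
      rw [Subgroup.coe_one] at this
      rw [if_neg hg]
      generalize agreement 1 (g : Equiv.Perm (Fin 12)) = x at *
      interval_cases x <;> norm_num
  have total := sum_le_sum fun g (_ : g ∈ (univ : Finset G)) => pointwise g
  simp only [sum_add_distrib, sum_sub_distrib, ← mul_sum, sum1, sum2, sum_const, card_univ, hG,
    ← card_eq fun g => agreement 1 g = 0, hD, sum_ite_eq, mem_univ, if_true, nsmul_eq_mul] at total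
  push_cast at total
  omega

open Finset in
/-- The ratio bound for intersecting subsets of a sharply 5-transitive group of degree 12, together
with the condition on the one-point marginals in the case of equality. -/
theorem card_le_of_intersecting {G : Subgroup (Equiv.Perm (Fin 12))} [Fintype G]
    [MulAction.IsMultiplyPretransitive G (Fin 12) 5] (hG : Fintype.card G = 95040)
    (h4 : ∀ π σ : G, agreement π σ ≤ 4 ∨ π = σ) (S : Finset G)
    (hS : ∀ π ∈ S, ∀ σ ∈ S, agreement π σ ≠ 0) :
    #S ≤ 7920 ∧ (#S = 7920 → ∀ g : G,
      ∑ i, (#{π ∈ S | π.1 i = g.1 i} : ℝ) =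
        7200 + 8640 * if g ∈ S then 1 else 0) := by
  obtain ⟨d, hd, hW⟩ := exists_card_derangements_mapping hG h4
  set r : G → Equiv.Perm (Fin 12) := Subtype.val
  set s : ℝ := (#S : ℝ) with hs
  set f : G → ℝ := fun g => if g ∈ S then 1 else 0 with hf
  set N : Fin 12 → Fin 12 → ℝ := fun i j => (#{π ∈ S | r π i = j} : ℝ) with hN
  have hNf (i j) : N i j = ∑ g, if r g i = j then f g else 0 := by
    simp only [hN, hf, card_filter, Nat.cast_sum, Nat.cast_ite, Nat.cast_one, Nat.cast_zero]
    rw [← sum_subset (subset_univ S)]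
    · exact sum_congr rfl fun g hg => by rw [if_pos hg]
    · intro g _ hg; simp [hg]
  have sum_f : ∑ g, f g = s := by simp [hf, hs]
  have row (i) : ∑ j, N i j = s := by
    simp only [hNf]; rw [sum_comm]; simp [sum_f]
  have col (j) : ∑ i, N i j = s := by
    simp only [hNf]; rw [sum_comm]
    have expand (g : G) : ∑ i, (if r g i = j then f g else 0) = f g := by
      simp [← Equiv.eq_symm_apply]
    simp [expand, sum_f]
  set F : G → ℝ := fun g => ∑ i, N i (r g i) with hF
  set h : G → ℝ := fun g => (11 * F g - 10 * s) / 95040 with hh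
  have total (i : Fin 12) (w : G → ℝ) : ∑ j, ∑ g, (if r g i = j then w g else 0) = ∑ g, w g := by
    rw [sum_comm]; simp
  have count1 (i j) : ∑ g, (if r g i = j then (1 : ℝ) else 0) = 7920 := by
    simp [card_apply_eq hG, r]
  have count2 (i j k l) : ∑ g, (if r g k = l then if r g i = j then (1 : ℝ) else 0 else 0) =
      if k = i then if l = j then 7920 else 0 else if l = j then 0 else 720 := by
    split_ifs with hk hl hl
    · subst hk hl
      simp only [← ite_and, and_self_iff, count1]
    · subst hk
      refine sum_eq_zero fun g _ => ?_
      split_ifs with h1 h2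
      · exact absurd (h1.symm.trans h2) hl
      all_goals rfl
    · subst hl
      refine sum_eq_zero fun g _ => ?_
      split_ifs with h1 h2
      · exact absurd ((r g).injective (h1.trans h2.symm)) hk
      all_goals rfl
    · simp only [← ite_and, sum_boole, r]
      rw [card_apply_eq_and_apply_eq hG hk hl]; norm_num
  have sum_ite_F (i j) : ∑ g, (if r g i = j then F g else 0) = 8640 * N i j + 7200 * s := by
    have := sum_mul_sum_apply r (fun g => if r g i = j then (1 : ℝ) else 0) N
    simp only [count2, ite_mul, one_mul, zero_mul] at this
    rw [this]
    have inner (k) : ∑ l, N k l *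
        (if k = i then if l = j then (7920 : ℝ) else 0 else if l = j then 0 else 720) =
        if k = i then 7920 * N i j else 720 * (s - N k j) := by
      split_ifs with hk
      · subst hk; simp [mul_comm]
      · have expand (l) : N k l * (if l = j then (0 : ℝ) else 720) =
          720 * (N k l - if l = j then N k l else 0) := by split_ifs <;> ring
        simp only [expand, ← mul_sum, sum_sub_distrib, row]
        simp
    simp only [inner]
    have expand (k) : (if k = i then 7920 * N i j else 720 * (s - N k j)) =
        720 * (s - N k j) + if k = i then 7920 * N i j - 720 * (s - N i j) else 0 := by
      split_ifs with hk
      · subst hk; ring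
      · ring
    simp only [expand, sum_add_distrib, ← mul_sum, sum_sub_distrib, col, sum_ite_eq', mem_univ,
      if_true, sum_const, card_univ, Fintype.card_fin, nsmul_eq_mul]
    push_cast
    ring
  have marginal (i j) : ∑ g, (if r g i = j then h g else 0) = N i j := by
    have expand (g) : (if r g i = j then h g else 0) =
        11 / 95040 * (if r g i = j then F g else 0) -
          10 * s / 95040 * (if r g i = j then 1 else 0) := by
      simp only [hh]; split_ifs <;> ring
    simp only [expand, sum_sub_distrib, ← mul_sum, sum_ite_F, count1]
    ring
  have sum_h : ∑ g, h g = s := by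
    rw [← total 0 h]; simp only [marginal, row]
  have marginal_sub (i j) : ∑ g, (if r g i = j then f g - h g else 0) = 0 := by
    have expand (g) : (if r g i = j then f g - h g else 0) =
        (if r g i = j then f g else 0) - (if r g i = j then h g else 0) := by
      split_ifs <;> simp
    simp only [expand, sum_sub_distrib, marginal, ← hNf, sub_self]
  have orthogonal : ∑ g, (f g - h g) * h g = 0 := by
    have h1 : ∑ g, (f g - h g) * F g = 0 := by
      have := sum_mul_sum_apply r (fun g => f g - h g) N
      simpa only [marginal_sub, mul_zero, sum_const_zero] using this
    have h2 : ∑ g, (f g - h g) = 0 := by rw [sum_sub_distrib, sum_f, sum_h, sub_self]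
    have h3 (g) : (f g - h g) * h g =
        11 / 95040 * ((f g - h g) * F g) - 10 * s / 95040 * (f g - h g) := by
      have : h g = (11 * F g - 10 * s) / 95040 := rfl
      linear_combination (f g - h g) * this
    rw [sum_congr rfl fun g _ => h3 g, sum_sub_distrib, ← mul_sum, ← mul_sum, h1, h2]
    ring
  set A : G → G → ℝ := fun π σ => if agreement (r π) (r σ) = 0 then 1 else 0 with hA
  have A_comm (π σ) : A π σ = A σ π := by simp [hA, agreement, eq_comm]
  have sum_ite_A (π k l) : ∑ σ, (if r σ k = l then A π σ else 0) =
      if r π k = l then 0 else (d : ℝ) := by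
    have := hW π k l
    simp only [hA, ← ite_and, sum_boole, and_comm (a := r _ k = l)]
    rw [this]; split_ifs <;> simp
  have sum_A (π) : ∑ σ, A π σ = 11 * d := by
    rw [← total 0 (A π)]
    have expand (l) : (if r π 0 = l then 0 else (d : ℝ)) = d - if r π 0 = l then (d : ℝ) else 0 := by
      split_ifs <;> ring
    simp only [sum_ite_A, expand, sum_sub_distrib, sum_ite_eq, mem_univ, if_true, sum_const,
      card_univ, Fintype.card_fin, nsmul_eq_mul]
    push_cast; ring
  have sum_A_F (π) : ∑ σ, A π σ * F σ = d * (12 * s - F π) := by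
    rw [sum_mul_sum_apply r (A π) N]
    have expand (k l) : N k l * (if r π k = l then 0 else (d : ℝ)) =
        d * (N k l - if r π k = l then N k l else 0) := by split_ifs <;> ring
    simp only [sum_ite_A, expand, ← mul_sum, sum_sub_distrib, row, sum_ite_eq, mem_univ, if_true,
      sum_const, card_univ, Fintype.card_fin, nsmul_eq_mul]
    push_cast; rfl
  have sum_A_h (π) : ∑ σ, A π σ * h σ = d * (12 * s / 95040 - h π) := by
    have expand (σ) : A π σ * h σ = 11 / 95040 * (A π σ * F σ) - 10 * s / 95040 * A π σ := by
      simp only [hh]; ring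
    rw [sum_congr rfl fun σ _ => expand σ, sum_sub_distrib, ← mul_sum, ← mul_sum, sum_A_F, sum_A]
    simp only [hh]
    ring
  have sum_A_f : ∑ π, ∑ σ, f π * f σ * A π σ = 0 := by
    refine sum_eq_zero fun π _ => sum_eq_zero fun σ _ => ?_
    simp only [hf, hA]
    split_ifs with h1 h2 h3
    · exact absurd h3 (hS π h1 σ h2)
    all_goals simp
  have form : ∑ π, ∑ σ, (f π - h π) * (f σ - h σ) * A π σ =
      -(2 * ∑ π, f π * ∑ σ, A π σ * h σ) + ∑ π, h π * ∑ σ, A π σ * h σ := by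
    have h1 : ∑ π, ∑ σ, h π * f σ * A π σ = ∑ π, f π * ∑ σ, A π σ * h σ := by
      rw [sum_comm]
      simp only [mul_sum]
      refine sum_congr rfl fun π _ => sum_congr rfl fun σ _ => ?_
      rw [A_comm σ π]; ring
    have h2 : ∑ π, ∑ σ, f π * h σ * A π σ = ∑ π, f π * ∑ σ, A π σ * h σ := by
      simp only [mul_sum]
      refine sum_congr rfl fun π _ => sum_congr rfl fun σ _ => by ring
    have h3 : ∑ π, ∑ σ, h π * h σ * A π σ = ∑ π, h π * ∑ σ, A π σ * h σ := by
      simp only [mul_sum]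
      refine sum_congr rfl fun π _ => sum_congr rfl fun σ _ => by ring
    have expand (π σ) : (f π - h π) * (f σ - h σ) * A π σ = f π * f σ * A π σ - f π * h σ * A π σ -
        h π * f σ * A π σ + h π * h σ * A π σ := by ring
    simp only [expand, sum_add_distrib, sum_sub_distrib, h1, h2, h3, sum_A_f]
    ring
  set q : ℝ := ∑ g, h g ^ 2 with hq
  have sum_f_h : ∑ g, f g * h g = q := by
    rw [hq, ← sub_eq_zero, ← sum_sub_distrib, ← orthogonal]
    exact sum_congr rfl fun g _ => by ring
  have norm_sub : ∑ g, (f g - h g) ^ 2 = s - q := by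
    have expand (g) : (f g - h g) ^ 2 = f g - 2 * (f g * h g) + h g ^ 2 := by
      have : f g ^ 2 = f g := by simp only [hf]; split_ifs <;> simp
      linear_combination this
    simp only [expand, sum_add_distrib, sum_sub_distrib, ← mul_sum, sum_f, sum_f_h, ← hq]
    ring
  have weighted (w : G → ℝ) : ∑ π, w π * ∑ σ, A π σ * h σ =
      d * (12 * s / 95040 * ∑ π, w π - ∑ π, w π * h π) := by
    simp only [sum_A_h]
    rw [mul_sub, mul_sum, mul_sum, mul_sum, ← sum_sub_distrib]
    exact sum_congr rfl fun π _ => by ring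
  have hbound := derangement_form_lower_bound r h4 (fun g => f g - h g) marginal_sub
  have sum_h_h : ∑ g, h g * h g = q := by simp only [hq, sq]
  change _ ≤ ∑ π, ∑ σ, (f π - h π) * (f σ - h σ) * A π σ at hbound
  rw [form, weighted, weighted, norm_sub, sum_f_h, sum_h_h, sum_f, sum_h] at hbound
  have hnn : 0 ≤ s - q := norm_sub ▸ sum_nonneg fun g _ => sq_nonneg _
  have hd' : (1123 : ℝ) ≤ d := by exact_mod_cast hd
  have s_nonneg : 0 ≤ s := Nat.cast_nonneg _
  constructor
  · by_contra! hlt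
    have hlt' : (7920 : ℝ) < s := by rw [hs]; exact_mod_cast hlt
    have h1 : 0 < s * (s - 7920) := by nlinarith
    nlinarith [mul_nonneg (sub_nonneg.mpr hd') hnn, mul_pos (by linarith : (0 : ℝ) < d) h1]
  · intro heq g
    have hs' : s = 7920 := by rw [hs, heq]; norm_num
    have hz : s - q = 0 := by
      rw [hs'] at hbound hnn ⊢
      nlinarith [mul_nonneg (sub_nonneg.mpr hd') hnn]
    rw [hz, sum_eq_zero_iff_of_nonneg fun g _ => sq_nonneg _] at norm_sub
    have := norm_sub g (mem_univ g)
    rw [sq_eq_zero_iff, sub_eq_zero] at this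
    change F g = 7200 + 8640 * f g
    simp only [this, hh, hs']
    ring

open Finset in
theorem exists_mem_eqOn {G : Subgroup (Equiv.Perm (Fin 12))}
    [h5 : MulAction.IsMultiplyPretransitive G (Fin 12) 5] (σ : Equiv.Perm (Fin 12))
    (T : Finset (Fin 12)) (hT : #T ≤ 5) : ∃ g : G, ∀ i ∈ T, (g : Equiv.Perm (Fin 12)) i = σ i := by
  obtain ⟨U, hTU, -, hU⟩ := exists_subsuperset_card_eq (subset_univ T) hT (by simp)
  let x : Fin 5 ↪ Fin 12 := (U.orderEmbOfFin hU).toEmbedding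
  obtain ⟨g, hg⟩ := h5.exists_smul_eq x (x.trans σ.toEmbedding)
  refine ⟨g, fun i hi => ?_⟩
  have : i ∈ Set.range (U.orderEmbOfFin hU) := by
    rw [range_orderEmbOfFin]; exact hTU hi
  obtain ⟨k, rfl⟩ := this
  exact DFunLike.congr_fun hg k

open Finset in
/-- In a 5-transitive group the values of a permutation sum control the values on the whole
symmetric group, provided there are only two of them. -/
theorem permutation_sum_eq_or_eq {G : Subgroup (Equiv.Perm (Fin 12))} [Fintype G]
    [MulAction.IsMultiplyPretransitive G (Fin 12) 5] (N : Fin 12 → Fin 12 → ℤ) (a b : ℤ)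
    (hN : ∀ g : G, ∑ i, N i ((g : Equiv.Perm (Fin 12)) i) = 12 * a ∨
      ∑ i, N i ((g : Equiv.Perm (Fin 12)) i) = 12 * b) (σ : Equiv.Perm (Fin 12)) :
    ∑ i, N i (σ i) = 12 * a ∨ ∑ i, N i (σ i) = 12 * b := by
  let H (τ : Equiv.Perm (Fin 12)) : ℤ := ∏ t : Fin 4, ∑ i, (N i (τ i) - ![a, a, b, b] t)
  have H_eq (τ) : H τ = ((∑ i, N i (τ i) - 12 * a) * (∑ i, N i (τ i) - 12 * b)) ^ 2 := by
    simp only [H, Fin.prod_univ_four, sum_sub_distrib, sum_const, card_univ, Fintype.card_fin,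
      nsmul_eq_mul]
    simp
    ring
  have expand (τ) : H τ = ∑ p : Fin 4 → Fin 12, ∏ t, (N (p t) (τ (p t)) - ![a, a, b, b] t) := by
    simp only [H, prod_univ_sum, Fintype.piFinset_univ]
  have invariant : ∑ g : G, H (g * σ) = ∑ g : G, H g := by
    simp only [expand]
    rw [sum_comm, sum_comm (s := (univ : Finset G))]
    refine sum_congr rfl fun p _ => ?_
    obtain ⟨τ, hτ⟩ := exists_mem_eqOn (G := G) σ (univ.image p)
      (card_image_le.trans (by simp))
    conv_rhs => rw [← Equiv.sum_comp (Equiv.mulRight τ)]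
    refine sum_congr rfl fun g _ => prod_congr rfl fun t _ => ?_
    have := hτ (p t) (mem_image_of_mem _ (mem_univ t))
    simp [this]
  have zero (g : G) : H g = 0 := by
    rw [H_eq]
    rcases hN g with h | h <;> rw [h] <;> ring
  simp only [zero, sum_const_zero] at invariant
  rw [sum_eq_zero_iff_of_nonneg fun g _ => by rw [H_eq]; positivity] at invariant
  have := invariant 1 (mem_univ _)
  rw [H_eq, sq_eq_zero_iff, mul_eq_zero, sub_eq_zero, sub_eq_zero] at this
  simpa using this

/-- Every sharply 5-transitive subgroup of `Sym(12)` (i.e. the Mathieu group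
`M₁₂`) has the strict EKR property: every intersecting subset has size at most
`7920 = 95040/12`, and the intersecting subsets of size `7920` are exactly the
cosets `S_{i,j} = {π ∈ G : π(i) = j}`. -/
theorem strict_ekr_sharply_five_transitive_degree_twelve
    (G : Subgroup (Equiv.Perm (Fin 12))) [Fintype G]
    (hsharp : ∀ a₁ a₂ a₃ a₄ a₅ b₁ b₂ b₃ b₄ b₅ : Fin 12,
      a₁ ≠ a₂ → a₁ ≠ a₃ → a₁ ≠ a₄ → a₁ ≠ a₅ → a₂ ≠ a₃ → a₂ ≠ a₄ → a₂ ≠ a₅ →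
      a₃ ≠ a₄ → a₃ ≠ a₅ → a₄ ≠ a₅ →
      b₁ ≠ b₂ → b₁ ≠ b₃ → b₁ ≠ b₄ → b₁ ≠ b₅ → b₂ ≠ b₃ → b₂ ≠ b₄ → b₂ ≠ b₅ →
      b₃ ≠ b₄ → b₃ ≠ b₅ → b₄ ≠ b₅ →
      ∃! g : G, (g : Equiv.Perm (Fin 12)) a₁ = b₁ ∧
        (g : Equiv.Perm (Fin 12)) a₂ = b₂ ∧
        (g : Equiv.Perm (Fin 12)) a₃ = b₃ ∧
        (g : Equiv.Perm (Fin 12)) a₄ = b₄ ∧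
        (g : Equiv.Perm (Fin 12)) a₅ = b₅) :
    ∀ S : Finset G,
      (∀ π ∈ S, ∀ σ ∈ S, ∃ x : Fin 12, ((π * σ⁻¹ : G) : Equiv.Perm (Fin 12)) x = x) →
      S.card ≤ 7920 ∧
      (S.card = 7920 → ∃ i j : Fin 12, S = Finset.univ.filter
        (fun g : G => (g : Equiv.Perm (Fin 12)) i = j)) := by
  classical
  have unique (x y : Fin 5 ↪ Fin 12) :
      ∃! g : G, ∀ k, (g : Equiv.Perm (Fin 12)) (x k) = y k := by
    have h := hsharp (x 0) (x 1) (x 2) (x 3) (x 4) (y 0) (y 1) (y 2) (y 3) (y 4)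
    simp only [ne_eq, EmbeddingLike.apply_eq_iff_eq] at h
    have hall (g : G) : (∀ k, (g : Equiv.Perm (Fin 12)) (x k) = y k) ↔
        (g : Equiv.Perm (Fin 12)) (x 0) = y 0 ∧ (g : Equiv.Perm (Fin 12)) (x 1) = y 1 ∧
        (g : Equiv.Perm (Fin 12)) (x 2) = y 2 ∧ (g : Equiv.Perm (Fin 12)) (x 3) = y 3 ∧
        (g : Equiv.Perm (Fin 12)) (x 4) = y 4 := by
      simp [Fin.forall_fin_succ]
    simp only [hall]
    apply h <;> decide
  have smul_eq_iff (g : G) (x y : Fin 5 ↪ Fin 12) :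
      g • x = y ↔ ∀ k, (g : Equiv.Perm (Fin 12)) (x k) = y k := DFunLike.ext_iff
  have : MulAction.IsMultiplyPretransitive G (Fin 12) 5 :=
    ⟨fun x y => (unique x y).exists.imp fun g hg => (smul_eq_iff g x y).mpr hg⟩
  have hG : Fintype.card G = 95040 := by
    let x : Fin 5 ↪ Fin 12 := Fin.castLEEmb (by norm_num)
    rw [← card_mul_card_smul_eq (Γ := G) (act := Function.Embedding.instMulAction) x x]
    have : (Finset.univ.filter fun g : G => g • x = x).card = 1 := by
      obtain ⟨g, hg, hg'⟩ := unique x x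
      rw [Finset.card_eq_one]
      refine ⟨g, Finset.eq_singleton_iff_unique_mem.mpr ⟨?_, fun k hk => ?_⟩⟩
      · exact Finset.mem_filter.mpr ⟨Finset.mem_univ _, (smul_eq_iff g x x).mpr hg⟩
      · exact hg' k ((smul_eq_iff k x x).mp (Finset.mem_filter.mp hk).2)
    have hX : Fintype.card (Fin 5 ↪ Fin 12) = 95040 := by
      simp [Fintype.card_embedding_eq, Nat.descFactorial]
    rw [hX]
    exact congrArg (95040 * ·) this
  have h4 (π σ : G) : agreement π σ ≤ 4 ∨ π = σ := by
    refine or_iff_not_imp_left.mpr fun h => ?_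
    obtain ⟨U, hU, hcard⟩ := Finset.exists_subset_card_eq (Nat.lt_of_not_le h)
    let x : Fin 5 ↪ Fin 12 := (U.orderEmbOfFin hcard).toEmbedding
    have hx (k) : (π : Equiv.Perm (Fin 12)) (x k) = (σ : Equiv.Perm (Fin 12)) (x k) :=
      (Finset.mem_filter.mp (hU (U.orderEmbOfFin_mem hcard k))).2
    exact (unique x (x.trans (σ : Equiv.Perm (Fin 12)).toEmbedding)).unique hx fun _ => rfl
  intro S hS
  have hS' : ∀ π ∈ S, ∀ σ ∈ S, agreement π σ ≠ 0 := by
    intro π hπ σ hσ h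
    obtain ⟨x, hx⟩ := hS π hπ σ hσ
    rw [agreement, Finset.card_eq_zero, Finset.filter_eq_empty_iff] at h
    refine h (Finset.mem_univ ((σ⁻¹ : Equiv.Perm (Fin 12)) x)) ?_
    simpa using hx
  obtain ⟨hle, heq⟩ := card_le_of_intersecting hG h4 S hS'
  refine ⟨hle, fun hcard => ?_⟩
  let N (i j : Fin 12) : ℤ := (S.filter fun π : G => π.1 i = j).card
  have hF (g : G) : ∑ i, N i ((g : Equiv.Perm (Fin 12)) i) = 12 * 600 ∨
      ∑ i, N i ((g : Equiv.Perm (Fin 12)) i) = 12 * 1320 := by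
    have h := heq hcard g
    have h' : ((∑ i, N i ((g : Equiv.Perm (Fin 12)) i) : ℤ) : ℝ) =
        7200 + 8640 * if g ∈ S then 1 else 0 := by
      rw [← h]; push_cast [N]; rfl
    split_ifs at h'
    · right; norm_num at h'; exact_mod_cast h'
    · left; norm_num at h'; exact_mod_cast h'
  have row (i) : ∑ j, N i j = 7920 := by
    have := Finset.card_eq_sum_card_fiberwise (s := S) (f := fun π : G => π.1 i)
      (t := Finset.univ) (by simp)
    rw [hcard] at this
    simp only [N]
    exact_mod_cast this.symm
  have col (j) : ∑ i, N i j = 7920 := by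
    have := Finset.card_eq_sum_card_fiberwise (s := S) (f := fun π : G => π.1.symm j)
      (t := Finset.univ) (by simp)
    rw [hcard] at this
    simp only [Equiv.symm_apply_eq, eq_comm (a := j)] at this
    simp only [N]
    exact_mod_cast this.symm
  obtain ⟨i, j, hij⟩ := exists_eq_of_permutation_sums N (fun _ _ => Int.natCast_nonneg _) row col
    (permutation_sum_eq_or_eq N 600 1320 hF)
  refine ⟨i, j, Finset.eq_of_subset_of_card_le (fun π hπ => ?_) ?_⟩
  · have hfilter : S.filter (fun π : G => π.1 i = j) = S :=
      Finset.eq_of_subset_of_card_le (Finset.filter_subset _ _) (by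
        rw [hcard]; exact Nat.cast_le.mp hij.ge)
    rw [← hfilter] at hπ
    exact Finset.mem_filter.mpr ⟨Finset.mem_univ _, (Finset.mem_filter.mp hπ).2⟩
  · rw [hcard, card_apply_eq hG]
end

section
/- Let n > 3 and let G be a 2-transitive subgroup of Sym(n) with exactly n−1 derangements, i.e., |D_G| = n−1 (so the derangement graph Γ_G is a disjoint union of |G|/n complete graphs K_n). Then G has the EKR property (every intersecting subset has size at most |G|/n) but does not have the strict EKR property: there exists an intersecting subset S ⊆ G with |S| = |G|/n such that S ≠ S_{i,j} for all i,j ∈ [n]. -/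
/-- In a 2-transitive group containing a derangement, some derangement maps `a` to `b`
whenever `a ≠ b`. -/
theorem exists_derangement_apply_eq {α : Type*} {G : Subgroup (Equiv.Perm α)}
    (h2t : ∀ a b c d : α, a ≠ b → c ≠ d →
      ∃ g : G, (g : Equiv.Perm α) a = c ∧ (g : Equiv.Perm α) b = d)
    {w : G} (hw : ∀ x, (w : Equiv.Perm α) x ≠ x) {a b : α} (hab : a ≠ b) :
    ∃ u : G, (∀ x, (u : Equiv.Perm α) x ≠ x) ∧ (u : Equiv.Perm α) a = b := by
  obtain ⟨g, hga, hgb⟩ := h2t a ((w : Equiv.Perm α) a) a b (hw a).symm hab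
  have hga' : (g : Equiv.Perm α).symm a = a := by
    rw [Equiv.symm_apply_eq, hga]
  refine ⟨g * w * g⁻¹, fun x hx => hw ((g : Equiv.Perm α)⁻¹ x) ?_, ?_⟩
  · rw [Equiv.Perm.eq_inv_iff_eq]
    simpa using hx
  · simp [hga', hgb]

/-- In a 2-transitive group of degree `n` with `n - 1` derangements, a derangement is
determined by its value at any point. -/
theorem derangement_eq_of_apply_eq {n : ℕ}
    {G : Subgroup (Equiv.Perm (Fin n))} [Fintype G]
    (h2t : ∀ a b c d : Fin n, a ≠ b → c ≠ d →
      ∃ g : G, (g : Equiv.Perm (Fin n)) a = c ∧ (g : Equiv.Perm (Fin n)) b = d)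
    (hder : (Finset.univ.filter
      fun g : G => ∀ x : Fin n, (g : Equiv.Perm (Fin n)) x ≠ x).card = n - 1)
    {u v : G} (hu : ∀ x, (u : Equiv.Perm (Fin n)) x ≠ x)
    (hv : ∀ x, (v : Equiv.Perm (Fin n)) x ≠ x) {a : Fin n}
    (huv : (u : Equiv.Perm (Fin n)) a = (v : Equiv.Perm (Fin n)) a) : u = v := by
  have himage : (Finset.univ.filter
      fun g : G => ∀ x : Fin n, (g : Equiv.Perm (Fin n)) x ≠ x).image
        (fun g : G => (g : Equiv.Perm (Fin n)) a) = Finset.univ.erase a := by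
    ext b
    simp only [Finset.mem_image, Finset.mem_filter, Finset.mem_univ, true_and,
      Finset.mem_erase, and_true]
    constructor
    · rintro ⟨g, hg, rfl⟩
      exact hg a
    · exact fun hb => exists_derangement_apply_eq h2t hu (Ne.symm hb)
  have hinj := Finset.injOn_of_card_image_eq (s := Finset.univ.filter
      fun g : G => ∀ x : Fin n, (g : Equiv.Perm (Fin n)) x ≠ x)
    (f := fun g : G => (g : Equiv.Perm (Fin n)) a)
    (by rw [himage, hder, Finset.card_erase_of_mem (Finset.mem_univ a)]; simp)
  exact hinj (by simpa using hu) (by simpa using hv) huv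


/-- If `G ≤ Sym(n)` is 2-transitive with `n > 3` and has exactly `n − 1`
derangements (so its derangement graph is a disjoint union of `|G|/n` copies of
`K_n`), then `G` has the EKR property but not the strict EKR property: every
intersecting subset has size at most `|G|/n`, and there is an intersecting
subset of size `|G|/n` that is not of the form `S_{i,j}`. -/
theorem ekr_but_not_strict_of_few_derangements {n : ℕ} (hn : 3 < n)
    (G : Subgroup (Equiv.Perm (Fin n))) [Fintype G] [DecidableEq G]
    (h2t : ∀ a b c d : Fin n, a ≠ b → c ≠ d →
      ∃ g : G, (g : Equiv.Perm (Fin n)) a = c ∧ (g : Equiv.Perm (Fin n)) b = d)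
    (hder : (Finset.univ.filter
      fun g : G => ∀ x : Fin n, (g : Equiv.Perm (Fin n)) x ≠ x).card = n - 1) :
    (∀ S : Finset G,
      (∀ π ∈ S, ∀ σ ∈ S, ∃ x : Fin n, ((π * σ⁻¹ : G) : Equiv.Perm (Fin n)) x = x) →
      (S.card : ℝ) ≤ (Fintype.card G : ℝ) / n) ∧
    (∃ S : Finset G,
      (∀ π ∈ S, ∀ σ ∈ S, ∃ x : Fin n, ((π * σ⁻¹ : G) : Equiv.Perm (Fin n)) x = x) ∧
      (S.card : ℝ) = (Fintype.card G : ℝ) / n ∧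
      ∀ i j : Fin n, S ≠ Finset.univ.filter
        (fun g : G => (g : Equiv.Perm (Fin n)) i = j)) := by
  classical
  have hfix : ∀ {u v : G}, (∀ x, (u : Equiv.Perm (Fin n)) x ≠ x) →
      (∀ x, (v : Equiv.Perm (Fin n)) x ≠ x) → ∀ {a : Fin n},
      (u : Equiv.Perm (Fin n)) a = (v : Equiv.Perm (Fin n)) a → u = v :=
    fun hu hv _ h => derangement_eq_of_apply_eq h2t hder hu hv h
  set D := Finset.univ.filter
    fun g : G => ∀ x : Fin n, (g : Equiv.Perm (Fin n)) x ≠ x with hD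
  have memD : ∀ g : G, g ∈ D ↔ ∀ x : Fin n, (g : Equiv.Perm (Fin n)) x ≠ x := by simp [hD]
  let o : Fin n := ⟨0, by lia⟩
  have hone : (1 : G) ∉ D := fun h => (memD 1).mp h o rfl
  obtain ⟨w, hw⟩ : D.Nonempty := Finset.card_pos.mp (by lia)
  set N := insert 1 D with hN
  have hNcard : N.card = n := by
    rw [hN, Finset.card_insert_of_notMem hone]
    lia
  -- `N` is semiregular: two elements agreeing at a point are equal.
  have hNeq : ∀ u ∈ N, ∀ v ∈ N, ∀ a : Fin n,
      (u : Equiv.Perm (Fin n)) a = (v : Equiv.Perm (Fin n)) a → u = v := by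
    intro u hu v hv a h
    rcases Finset.mem_insert.mp hu with rfl | hu <;> rcases Finset.mem_insert.mp hv with rfl | hv
    · rfl
    · exact absurd h.symm ((memD v).mp hv a)
    · exact absurd h ((memD u).mp hu a)
    · exact hfix ((memD u).mp hu) ((memD v).mp hv) h
  have hNtrans : ∀ a b : Fin n, ∃ u ∈ N, (u : Equiv.Perm (Fin n)) a = b := by
    intro a b
    by_cases hab : a = b
    · exact ⟨1, Finset.mem_insert_self _ _, by simp [hab]⟩
    · obtain ⟨u, hu, huab⟩ := exists_derangement_apply_eq h2t ((memD w).mp hw) hab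
      exact ⟨u, Finset.mem_insert_of_mem ((memD u).mpr hu), huab⟩
  have hupper : ∀ S : Finset G,
      (∀ π ∈ S, ∀ σ ∈ S, ∃ x : Fin n, ((π * σ⁻¹ : G) : Equiv.Perm (Fin n)) x = x) →
      S.card * n ≤ Fintype.card G := by
    intro S hS
    refine (congrArg (S.card * ·) hNcard).ge.trans ?_
    rw [← Finset.card_product, ← Finset.card_univ]
    refine Finset.card_le_card_of_injOn (fun p => p.2 * p.1) (fun _ _ => Finset.mem_univ _) ?_
    rintro ⟨s, u⟩ hp ⟨t, v⟩ hq h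
    simp only [Finset.coe_product, Set.mem_prod, Finset.mem_coe] at hp hq h
    obtain ⟨x, hx⟩ := hS s hp.1 t hq.1
    have hvu : v = u * (s * t⁻¹) := by rw [← mul_assoc, h, mul_inv_cancel_right]
    have huv : u = v := hNeq u hp.2 v hq.2 x (by
      rw [hvu, Subgroup.coe_mul, Equiv.Perm.mul_apply, hx])
    subst huv
    rw [mul_left_cancel h]
  have hnpos : (0 : ℝ) < n := by exact_mod_cast (by lia : 0 < n)
  refine ⟨fun S hS => ?_, ?_⟩
  · rw [le_div_iff₀ hnpos]
    exact_mod_cast hupper S hS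
  -- Replace the identity in the stabilizer of `o` by the derangement `w`.
  set T := Finset.univ.filter (fun g : G => (g : Equiv.Perm (Fin n)) o = o) with hT
  have memT : ∀ g : G, g ∈ T ↔ (g : Equiv.Perm (Fin n)) o = o := by simp [hT]
  have hwD := (memD w).mp hw
  have honeT : (1 : G) ∈ T := (memT 1).mpr rfl
  have hwT : w ∉ T.erase 1 := fun h => hwD o ((memT w).mp (Finset.mem_of_mem_erase h))
  have hcard : (insert w (T.erase 1)).card = T.card := by
    rw [Finset.card_insert_of_notMem hwT, Finset.card_erase_add_one honeT]
  have hlower : Fintype.card G ≤ T.card * n := by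
    refine le_of_le_of_eq ?_ (congrArg (T.card * ·) hNcard)
    rw [← Finset.card_product, ← Finset.card_univ]
    refine Finset.card_le_card_of_surjOn (fun p => p.2 * p.1) fun g _ => ?_
    obtain ⟨u, hu, huo⟩ := hNtrans o ((g : Equiv.Perm (Fin n)) o)
    refine ⟨(u⁻¹ * g, u), ?_, by simp⟩
    simp only [Finset.coe_product, Set.mem_prod, Finset.mem_coe]
    refine ⟨(memT _).mpr ?_, hu⟩
    simp [← huo]
  have hmix : ∀ t ∈ T.erase 1, ∃ x : Fin n, ((w * t⁻¹ : G) : Equiv.Perm (Fin n)) x = x := by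
    intro t ht
    obtain ⟨ht1, ht⟩ := Finset.mem_erase.mp ht
    by_contra! hno
    have hto : (t : Equiv.Perm (Fin n)).symm o = o := by
      rw [Equiv.symm_apply_eq, (memT t).mp ht]
    have := hfix hno hwD (a := o) (by simp [hto])
    exact ht1 (by simpa using this)
  have hint : ∀ π ∈ insert w (T.erase 1), ∀ σ ∈ insert w (T.erase 1),
      ∃ x : Fin n, ((π * σ⁻¹ : G) : Equiv.Perm (Fin n)) x = x := by
    intro π hπ σ hσ
    rw [Finset.mem_insert] at hπ hσ
    rcases hπ with rfl | hπ <;> rcases hσ with rfl | hσ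
    · exact ⟨o, by simp⟩
    · exact hmix σ hσ
    · obtain ⟨x, hx⟩ := hmix π hπ
      refine ⟨x, ?_⟩
      simpa using Equiv.Perm.inv_eq_iff_eq.mpr hx.symm
    · have h1 := (memT π).mp (Finset.mem_of_mem_erase hπ)
      have h2 := (memT σ).mp (Finset.mem_of_mem_erase hσ)
      refine ⟨o, ?_⟩
      have h3 : (σ : Equiv.Perm (Fin n)).symm o = o := by rw [Equiv.symm_apply_eq, h2]
      simp [h1, h3]
  refine ⟨insert w (T.erase 1), hint, ?_, ?_⟩
  · rw [eq_div_iff hnpos.ne']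
    exact_mod_cast le_antisymm (hupper _ hint) (hcard ▸ hlower)
  intro i j hij
  have hval : ∀ g ∈ insert w (T.erase 1), (g : Equiv.Perm (Fin n)) i = j := by
    intro g hg
    rw [hij] at hg
    simpa using hg
  have hmove : ∀ a b : Fin n, a ≠ o → b ≠ o → b ≠ a →
      ∃ g ∈ T.erase 1, (g : Equiv.Perm (Fin n)) a = b := by
    intro a b ha hb hba
    obtain ⟨g, hgo, hga⟩ := h2t o a o b ha.symm hb.symm
    refine ⟨g, Finset.mem_erase.mpr ⟨?_, (memT g).mpr hgo⟩, hga⟩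
    rintro rfl
    exact hba hga.symm
  have hpick : ∀ s : Finset (Fin n), s.card ≤ 3 → ∃ b, b ∉ s := by
    intro s hs
    by_contra! h
    have := Finset.card_le_card (fun x _ => h x : Finset.univ ⊆ s)
    rw [Finset.card_univ, Fintype.card_fin] at this
    lia
  by_cases hi : i = o
  · obtain ⟨a, ha⟩ := hpick {o} (by simp)
    obtain ⟨b, hb⟩ := hpick {o, a} (Finset.card_le_two.trans (by lia))
    simp only [Finset.mem_insert, Finset.mem_singleton, not_or] at ha hb
    obtain ⟨g, hg, -⟩ := hmove a b ha hb.1 hb.2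
    have hgo := (memT g).mp (Finset.mem_of_mem_erase hg)
    have h1 := hval g (Finset.mem_insert_of_mem hg)
    have h2 := hval w (Finset.mem_insert_self _ _)
    subst hi
    exact hwD _ (h2.trans (h1.symm.trans hgo))
  · obtain ⟨b, hb⟩ := hpick {o, i} (Finset.card_le_two.trans (by lia))
    obtain ⟨c, hc⟩ := hpick {o, i, b} Finset.card_le_three
    simp only [Finset.mem_insert, Finset.mem_singleton, not_or] at hb hc
    obtain ⟨g, hg, hgi⟩ := hmove i b hi hb.1 hb.2
    obtain ⟨k, hk, hki⟩ := hmove i c hi hc.1 hc.2.1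
    have h1 := hval g (Finset.mem_insert_of_mem hg)
    have h2 := hval k (Finset.mem_insert_of_mem hk)
    exact hc.2.2 (by rw [← hki, ← hgi, h1, h2])
end
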